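/- arXiv:2503.22651 — 5 statements merged into one kernel-verified Lean document; each statement's English description precedes it below -/
import Mathlib

section
/- Let D ≥ 1 be an integer, let f_X, f_Y : ℝ^D → ℕ be finitely supported functions, and let w and ℓ be positive integers with w ≥ 4ℓ. Then there exists an offset x ∈ [0,w]^D such that: (1) f_X(C_2) ≤ (4ℓD/w)^2 · f_X(ℝ^D), where C_2 is the set of points p ∈ ℝ^D for which there exist two distinct coordinates i ≠ j and integers k, k' with |p_i − x_i − k w| ≤ 2ℓ and |p_j − x_j − k' w| ≤ 2ℓ; and (2) f_Y(C_1) ≤ (8ℓD/w) · f_Y(ℝ^D), where C_1 is the set of points p ∈ ℝ^D for which there exist a coordinate i and an integer k with |p_i − x_i − k w| ≤ 2ℓ. -/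
open MeasureTheory

/-- A nonnegative weighted count of events of probability at most `α / 2` admits a nonnegative
normalization of mean at most `1 / 2`, whose values at most `1` certify a fraction at most `α`. -/
theorem exists_integrable_of_measureReal_le_half {Ω ι : Type*} [MeasurableSpace Ω]
    (μ : Measure Ω) [IsProbabilityMeasure μ] (S : Finset ι) (a : ι → ℝ) (ha : ∀ p, 0 ≤ a p)
    (E : ι → Set Ω) (hE : ∀ p, MeasurableSet (E p)) {α : ℝ} (hα : 0 < α)
    (hEα : ∀ p, μ.real (E p) ≤ α / 2) :
    ∃ g : Ω → ℝ, Integrable g μ ∧ ∫ ω, g ω ∂μ ≤ 1 / 2 ∧ (∀ ω, 0 ≤ g ω) ∧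
      ∀ ω, g ω ≤ 1 → ∑ p ∈ S, a p * (E p).indicator 1 ω ≤ α * ∑ p ∈ S, a p := by
  have hnonneg : ∀ p ω, 0 ≤ a p * (E p).indicator (1 : Ω → ℝ) ω := fun p ω =>
    mul_nonneg (ha p) (Set.indicator_nonneg (fun _ _ => zero_le_one) _)
  have hint : ∀ p ∈ S, Integrable (fun ω => a p * (E p).indicator (1 : Ω → ℝ) ω) μ :=
    fun p _ => ((integrable_const (1 : ℝ)).indicator (hE p)).const_mul (a p)
  rcases (Finset.sum_nonneg fun p (_ : p ∈ S) => ha p).eq_or_lt with h0 | hpos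
  · refine ⟨0, integrable_zero _ _ _, by simp, fun _ => le_rfl, fun ω _ => ?_⟩
    have hz := (Finset.sum_eq_zero_iff_of_nonneg fun p _ => ha p).1 h0.symm
    rw [← h0, mul_zero]
    exact (Finset.sum_eq_zero fun p hp => by rw [hz p hp, zero_mul]).le
  · have hαs : 0 < α * ∑ p ∈ S, a p := mul_pos hα hpos
    refine ⟨fun ω => (∑ p ∈ S, a p * (E p).indicator 1 ω) / (α * ∑ p ∈ S, a p),
      (integrable_finsetSum S hint).div_const _, ?_,
      fun ω => div_nonneg (Finset.sum_nonneg fun p _ => hnonneg p ω) hαs.le,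
      fun ω h => (div_le_one hαs).1 h⟩
    rw [integral_div, integral_finsetSum S hint, div_le_iff₀ hαs]
    calc ∑ p ∈ S, ∫ ω, a p * (E p).indicator 1 ω ∂μ
        = ∑ p ∈ S, a p * μ.real (E p) := by
          refine Finset.sum_congr rfl fun p _ => ?_
          rw [integral_const_mul, integral_indicator_one (hE p)]
      _ ≤ ∑ p ∈ S, a p * (α / 2) :=
          Finset.sum_le_sum fun p _ => mul_le_mul_of_nonneg_left (hEα p) (ha p)
      _ = 1 / 2 * (α * ∑ p ∈ S, a p) := by rw [← Finset.sum_mul]; ring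

/-- If two finite families of events have probabilities at most `α / 2` and `β / 2`, then at some
outcome the weighted fractions of occurring events are at most `α` and `β` simultaneously. -/
theorem exists_sum_indicator_le_and_le {Ω ι κ : Type*} [MeasurableSpace Ω] (μ : Measure Ω)
    [IsProbabilityMeasure μ] (S : Finset ι) (T : Finset κ) (a : ι → ℝ) (b : κ → ℝ)
    (ha : ∀ p, 0 ≤ a p) (hb : ∀ q, 0 ≤ b q) (E : ι → Set Ω) (F : κ → Set Ω)
    (hE : ∀ p, MeasurableSet (E p)) (hF : ∀ q, MeasurableSet (F q)) {α β : ℝ}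
    (hα : 0 < α) (hβ : 0 < β) (hEα : ∀ p, μ.real (E p) ≤ α / 2)
    (hFβ : ∀ q, μ.real (F q) ≤ β / 2) :
    ∃ ω, ∑ p ∈ S, a p * (E p).indicator 1 ω ≤ α * ∑ p ∈ S, a p ∧
      ∑ q ∈ T, b q * (F q).indicator 1 ω ≤ β * ∑ q ∈ T, b q := by
  obtain ⟨g, hgi, hg, hg0, hgS⟩ := exists_integrable_of_measureReal_le_half μ S a ha E hE hα hEα
  obtain ⟨h, hhi, hh, hh0, hhT⟩ := exists_integrable_of_measureReal_le_half μ T b hb F hF hβ hFβ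
  obtain ⟨ω, hω⟩ := exists_le_integral (hgi.add hhi)
  rw [integral_add' hgi hhi] at hω
  have hsum : g ω + h ω ≤ 1 := by
    rw [Pi.add_apply] at hω
    linarith
  exact ⟨ω, hgS ω (by linarith [hh0 ω]), hhT ω (by linarith [hg0 ω])⟩

/-- The number of strictly increasing pairs of indices is at most half of the number of pairs. -/
theorem two_mul_card_filter_fst_lt_snd_le (ι : Type*) [Fintype ι] [LinearOrder ι] :
    2 * (Finset.univ.filter fun q : ι × ι => q.1 < q.2).card ≤ Fintype.card ι ^ 2 := by
  have hswap : (Finset.univ.filter fun q : ι × ι => q.2 < q.1).card =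
      (Finset.univ.filter fun q : ι × ι => q.1 < q.2).card :=
    Finset.card_equiv (Equiv.prodComm ι ι) (by simp)
  have hdisj : Disjoint (Finset.univ.filter fun q : ι × ι => q.1 < q.2)
      (Finset.univ.filter fun q : ι × ι => q.2 < q.1) :=
    Finset.disjoint_filter.2 fun q _ h => h.not_gt
  have hcard := Finset.card_le_univ ((Finset.univ.filter fun q : ι × ι => q.1 < q.2).disjUnion
    (Finset.univ.filter fun q : ι × ι => q.2 < q.1) hdisj)
  rw [Finset.card_disjUnion, hswap, Fintype.card_prod] at hcard
  nlinarith

namespace AddCircle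

theorem coe_mem_closedBall_of_abs_sub_sub_le {T x y r : ℝ} {k : ℤ}
    (h : |y - x - k * T| ≤ r) :
    (x : AddCircle T) ∈ Metric.closedBall (y : AddCircle T) r := by
  have hk : ((k * T : ℝ) : AddCircle T) = 0 := by
    rw [coe_eq_zero_iff]
    exact ⟨k, by simp⟩
  have heq : (y : AddCircle T) - x = ((y - x - k * T : ℝ) : AddCircle T) := by
    rw [coe_sub, coe_sub, hk, sub_zero]
  rw [Metric.mem_closedBall, dist_comm, dist_eq_norm, heq]
  exact QuotientAddGroup.norm_mk_le_norm.trans h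

variable {T : ℝ} [hT : Fact (0 < T)]

theorem haarAddCircle_real_closedBall_le (c : AddCircle T) {r : ℝ} (hr : 0 ≤ r) :
    haarAddCircle.real (Metric.closedBall c r) ≤ 2 * r / T := by
  have hvol : volume.real (Metric.closedBall c r) = min T (2 * r) := by
    rw [measureReal_def, volume_closedBall, ENNReal.toReal_ofReal]
    exact le_min hT.out.le (by positivity)
  rw [volume_eq_smul_haarAddCircle, measureReal_ennreal_smul_apply,
    ENNReal.toReal_ofReal hT.out.le] at hvol
  rw [le_div_iff₀ hT.out, mul_comm, hvol]
  exact min_le_right _ _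

variable {ι : Type*} [Fintype ι]

theorem pi_haarAddCircle_real_iUnion_le (c : ι → AddCircle T) {r : ℝ} (hr : 0 ≤ r) :
    (Measure.pi fun _ : ι => haarAddCircle (T := T)).real
        (⋃ i, Function.eval i ⁻¹' Metric.closedBall (c i) r) ≤
      Fintype.card ι * (2 * r / T) := by
  refine (measureReal_iUnion_fintype_le _).trans ?_
  rw [← nsmul_eq_mul]
  refine Finset.sum_le_card_nsmul _ _ _ fun i _ => ?_
  rw [(measurePreserving_eval (fun _ : ι => haarAddCircle (T := T)) i).measureReal_preimage
    Metric.isClosed_closedBall.measurableSet.nullMeasurableSet]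
  exact haarAddCircle_real_closedBall_le _ hr

theorem pi_haarAddCircle_real_inter_le (c : ι → AddCircle T) {r : ℝ} (hr : 0 ≤ r) {i j : ι}
    (hij : i ≠ j) :
    (Measure.pi fun _ : ι => haarAddCircle (T := T)).real
        (Function.eval i ⁻¹' Metric.closedBall (c i) r ∩
          Function.eval j ⁻¹' Metric.closedBall (c j) r) ≤
      (2 * r / T) ^ 2 := by
  have hind := (ProbabilityTheory.iIndepFun_pi (μ := fun _ : ι => haarAddCircle (T := T))
    (X := fun _ => id) fun _ => aemeasurable_id).indepFun hij
  have hmul := hind.measure_inter_preimage_eq_mul _ _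
    (Metric.isClosed_closedBall (x := c i) (ε := r)).measurableSet
    (Metric.isClosed_closedBall (x := c j) (ε := r)).measurableSet
  have heval (i : ι) := (measurePreserving_eval
    (fun _ : ι => haarAddCircle (T := T)) i).measure_preimage
    (Metric.isClosed_closedBall (x := c i) (ε := r)).measurableSet.nullMeasurableSet
  have hmul' := hmul.trans (congrArg₂ (· * ·) (heval i) (heval j))
  rw [measureReal_def]
  refine (congrArg ENNReal.toReal hmul').trans_le ?_
  rw [ENNReal.toReal_mul, sq]
  exact mul_le_mul (haarAddCircle_real_closedBall_le _ hr) (haarAddCircle_real_closedBall_le _ hr)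
    ENNReal.toReal_nonneg (div_nonneg (by positivity) hT.out.le)

theorem pi_haarAddCircle_real_iUnion_inter_le [LinearOrder ι] (c : ι → AddCircle T) {r : ℝ}
    (hr : 0 ≤ r) :
    (Measure.pi fun _ : ι => haarAddCircle (T := T)).real
        (⋃ q ∈ Finset.univ.filter fun q : ι × ι => q.1 < q.2,
          Function.eval q.1 ⁻¹' Metric.closedBall (c q.1) r ∩
          Function.eval q.2 ⁻¹' Metric.closedBall (c q.2) r) ≤
      (2 * r * Fintype.card ι / T) ^ 2 / 2 := by
  refine (measureReal_biUnion_finset_le _ _).trans ?_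
  refine (Finset.sum_le_card_nsmul _ _ ((2 * r / T) ^ 2) fun q hq =>
    pi_haarAddCircle_real_inter_le c hr (Finset.mem_filter.1 hq).2.ne).trans ?_
  have hcard : (2 : ℝ) * (Finset.univ.filter fun q : ι × ι => q.1 < q.2).card ≤
      (Fintype.card ι : ℝ) ^ 2 := mod_cast two_mul_card_filter_fst_lt_snd_le ι
  rw [nsmul_eq_mul, le_div_iff₀ two_pos]
  calc _ = 2 * ((Finset.univ.filter fun q : ι × ι => q.1 < q.2).card : ℝ) * (2 * r / T) ^ 2 := by
        ring
    _ ≤ (Fintype.card ι : ℝ) ^ 2 * (2 * r / T) ^ 2 := by gcongr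
    _ = (2 * r * Fintype.card ι / T) ^ 2 := by ring

end AddCircle

/-- The mass of a finitely supported function on a set is bounded by the sum over its support of
the values times the indicator of a condition implied by membership in the set. -/
theorem finsum_mem_natCast_le_sum_mul_indicator {ι Ω : Type*} {f : ι → ℕ}
    (hf : (Function.support f).Finite) (C : Set ι) (E : ι → Set Ω) (ω : Ω)
    (hCE : ∀ p ∈ C, ω ∈ E p) :
    ((∑ᶠ p ∈ C, f p : ℕ) : ℝ) ≤
      ∑ p ∈ hf.toFinset, (f p : ℝ) * (E p).indicator 1 ω := by
  classical
  rw [finsum_mem_def, finsum_eq_sum_of_support_subset (s := hf.toFinset), Nat.cast_sum]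
  · refine Finset.sum_le_sum fun p _ => ?_
    by_cases hp : p ∈ C
    · simp [hp, hCE p hp]
    · rw [Set.indicator_of_notMem hp, Nat.cast_zero]
      exact mul_nonneg (Nat.cast_nonneg _) (Set.indicator_nonneg (fun _ _ => zero_le_one) _)
  · rw [Set.support_indicator, hf.coe_toFinset]
    exact Set.inter_subset_right

/-- **Tiling Lemma.** For finitely supported `f_X, f_Y : ℝ^D → ℕ` and positive integers
`w ≥ 4ℓ`, there is a grid offset `x ∈ [0,w]^D` such that at most a `(4ℓD/w)^2` fraction of
the mass of `f_X` is within `ℓ_∞`-distance `2ℓ` of a codimension-2 face of the grid, and at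
most an `(8ℓD/w)` fraction of the mass of `f_Y` is within `ℓ_∞`-distance `2ℓ` of a
codimension-1 face of the grid. -/
theorem tiling_lemma (D : ℕ) (hD : 1 ≤ D) (fX fY : EuclideanSpace ℝ (Fin D) → ℕ)
    (hfX : (Function.support fX).Finite) (hfY : (Function.support fY).Finite)
    (w ℓ : ℕ) (hℓ : 0 < ℓ) (hw : 4 * ℓ ≤ w) :
    ∃ x : EuclideanSpace ℝ (Fin D), (∀ i, x i ∈ Set.Icc (0 : ℝ) w) ∧
      ((∑ᶠ p ∈ {p : EuclideanSpace ℝ (Fin D) | ∃ i j : Fin D, i ≠ j ∧ ∃ k k' : ℤ,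
          |p i - x i - k * w| ≤ 2 * ℓ ∧ |p j - x j - k' * w| ≤ 2 * ℓ}, fX p : ℕ) : ℝ) ≤
        (4 * (ℓ : ℝ) * D / w) ^ 2 * ((∑ᶠ p, fX p : ℕ) : ℝ) ∧
      ((∑ᶠ p ∈ {p : EuclideanSpace ℝ (Fin D) | ∃ i : Fin D, ∃ k : ℤ,
          |p i - x i - k * w| ≤ 2 * ℓ}, fY p : ℕ) : ℝ) ≤
        (8 * (ℓ : ℝ) * D / w) * ((∑ᶠ p, fY p : ℕ) : ℝ) := by
  have hw0 : (0 : ℝ) < w := by exact_mod_cast (by omega : 0 < w)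
  have hℓ0 : (0 : ℝ) < ℓ := by exact_mod_cast hℓ
  have hD0 : (0 : ℝ) < D := by exact_mod_cast hD
  have : Fact ((0 : ℝ) < w) := ⟨hw0⟩
  have hmeas (p : EuclideanSpace ℝ (Fin D)) (i : Fin D) :
      MeasurableSet (Function.eval i ⁻¹'
        Metric.closedBall (p i : AddCircle (w : ℝ)) (2 * ℓ) : Set (Fin D → AddCircle (w : ℝ))) :=
    measurable_pi_apply i Metric.isClosed_closedBall.measurableSet
  obtain ⟨ω, hωX, hωY⟩ := exists_sum_indicator_le_and_le
    (Measure.pi fun _ : Fin D => AddCircle.haarAddCircle (T := (w : ℝ)))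
    hfX.toFinset hfY.toFinset (fun p => (fX p : ℝ)) (fun p => (fY p : ℝ))
    (fun _ => Nat.cast_nonneg _) (fun _ => Nat.cast_nonneg _)
    (fun p => ⋃ q ∈ Finset.univ.filter fun q : Fin D × Fin D => q.1 < q.2,
      Function.eval q.1 ⁻¹' Metric.closedBall (p q.1 : AddCircle (w : ℝ)) (2 * ℓ) ∩
      Function.eval q.2 ⁻¹' Metric.closedBall (p q.2 : AddCircle (w : ℝ)) (2 * ℓ))
    (fun p => ⋃ i, Function.eval i ⁻¹' Metric.closedBall (p i : AddCircle (w : ℝ)) (2 * ℓ))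
    (fun p => Finset.measurableSet_biUnion _ fun q _ => (hmeas p q.1).inter (hmeas p q.2))
    (fun p => MeasurableSet.iUnion (hmeas p))
    (α := (4 * (ℓ : ℝ) * D / w) ^ 2) (β := 8 * (ℓ : ℝ) * D / w)
    (by positivity) (by positivity)
    (fun p => (AddCircle.pi_haarAddCircle_real_iUnion_inter_le
      (fun i => (p i : AddCircle (w : ℝ))) (by positivity)).trans_eq (by
        rw [Fintype.card_fin]; ring))
    (fun p => (AddCircle.pi_haarAddCircle_real_iUnion_le
      (fun i => (p i : AddCircle (w : ℝ))) (by positivity)).trans_eq (by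
        rw [Fintype.card_fin]; ring))
  have hrep (i : Fin D) : ∃ y ∈ Set.Ico (0 : ℝ) (0 + w), (y : AddCircle (w : ℝ)) = ω i :=
    (AddCircle.coe_image_Ico_eq (w : ℝ) 0).ge (Set.mem_univ (ω i))
  choose y hy hyω using hrep
  refine ⟨WithLp.toLp 2 y, fun i => ⟨(hy i).1, by simpa using (hy i).2.le⟩, ?_, ?_⟩
  · rw [finsum_eq_sum_of_support_subset fX hfX.coe_toFinset.ge, Nat.cast_sum]
    refine (finsum_mem_natCast_le_sum_mul_indicator hfX _ _ ω ?_).trans hωX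
    rintro p ⟨i, j, hij, k, k', hi, hj⟩
    have hi' := AddCircle.coe_mem_closedBall_of_abs_sub_sub_le hi
    have hj' := AddCircle.coe_mem_closedBall_of_abs_sub_sub_le hj
    rw [hyω] at hi' hj'
    rcases hij.lt_or_gt with h | h
    · exact Set.mem_biUnion (x := (i, j)) (by simpa using h) ⟨hi', hj'⟩
    · exact Set.mem_biUnion (x := (j, i)) (by simpa using h) ⟨hj', hi'⟩
  · rw [finsum_eq_sum_of_support_subset fY hfY.coe_toFinset.ge, Nat.cast_sum]
    refine (finsum_mem_natCast_le_sum_mul_indicator hfY _ _ ω ?_).trans hωY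
    rintro p ⟨i, k, hi⟩
    have hi' := AddCircle.coe_mem_closedBall_of_abs_sub_sub_le hi
    rw [hyω] at hi'
    exact Set.mem_iUnion.2 ⟨i, hi'⟩
end

section
/- Define f : [2,∞) → ℝ by f(t) = √t · (v(t) / (2 · 4^{t+1} · t))^{1/(t−1)}, where v(t) = π^{t/2} / Γ(t/2 + 1) is the volume of the unit ball in dimension t (extended to real t via the Gamma function Γ). Then f is strictly increasing on [2,∞), and f(2) = √2 · π / 256 ≥ 1/90. -/
open Real Set Filter Topology

lemma convexOn_mul_log_sub_mul_log_add_one :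
    ConvexOn ℝ (Ioi 0) fun x : ℝ => x * log x - x * log (x + 1) := by
  refine convexOn_of_hasDerivWithinAt2_nonneg (convex_Ioi 0)
    (f' := fun x => log x - log (x + 1) + 1 / (x + 1))
    (f'' := fun x => 1 / x - 1 / (x + 1) - 1 / (x + 1) ^ 2) ?_ ?_ ?_ ?_
  · refine fun x (hx : 0 < x) => ContinuousAt.continuousWithinAt ?_
    have h₀ : x ≠ 0 := hx.ne'
    have h₁ : x + 1 ≠ 0 := by positivity
    fun_prop (disch := assumption)
  · rw [interior_Ioi]
    intro x (hx : 0 < x)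
    have h₀ : x ≠ 0 := hx.ne'
    have h₁ : x + 1 ≠ 0 := by positivity
    have h := ((hasDerivAt_id x).mul (hasDerivAt_log h₀)).sub
      ((hasDerivAt_id x).mul (((hasDerivAt_id x).add_const 1).log h₁))
    refine (h.congr_deriv ?_).hasDerivWithinAt
    simp only [id]
    field_simp
    ring
  · rw [interior_Ioi]
    intro x (hx : 0 < x)
    have h₀ : x ≠ 0 := hx.ne'
    have h₁ : x + 1 ≠ 0 := by positivity
    have h := ((hasDerivAt_log h₀).sub (((hasDerivAt_id x).add_const 1).log h₁)).add
      (((hasDerivAt_id x).add_const 1).inv h₁)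
    simp only [one_div]
    refine (h.congr_deriv ?_).hasDerivWithinAt
    simp only [id]
    field_simp
    ring
  · rw [interior_Ioi]
    intro x (hx : 0 < x)
    have h : 1 / x - 1 / (x + 1) - 1 / (x + 1) ^ 2 = 1 / (x * (x + 1) ^ 2) := by
      field_simp
      ring
    rw [h]
    positivity

lemma ConvexOn.comp_add_natCast {g : ℝ → ℝ} (hg : ConvexOn ℝ (Ioi 0) g) (n : ℕ) :
    ConvexOn ℝ (Ioi 0) fun x => g (x + n) :=
  (hg.translate_left (n : ℝ)).subset
    (fun x (hx : 0 < x) => show 0 < n + x by positivity) (convex_Ioi 0)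

lemma convexOn_mul_log_add_sum_log (n : ℕ) :
    ConvexOn ℝ (Ioi 0) fun x : ℝ => x * log x + ∑ m ∈ Finset.range n, log (x + (m + 1 : ℕ)) := by
  have key : ConvexOn ℝ (Ioi 0) fun x : ℝ =>
      x * log x + ∑ m ∈ Finset.range n, log (x + (m + 1 : ℕ)) - (x + n) * log (x + n) := by
    induction n with
    | zero => simpa using convexOn_const (0 : ℝ) (convex_Ioi (0 : ℝ))
    | succ n ih =>
      refine (ih.add (convexOn_mul_log_sub_mul_log_add_one.comp_add_natCast n)).congr ?_
      intro x _
      simp only [Pi.add_apply, Finset.sum_range_succ, Nat.cast_add, Nat.cast_one, ← add_assoc]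
      ring
  refine (key.add ((convexOn_mul_log.subset Ioi_subset_Ici_self
    (convex_Ioi 0)).comp_add_natCast n)).congr fun x _ => ?_
  simp only [Pi.add_apply]
  ring

lemma ConvexOn.of_tendsto {s : Set ℝ} {F : ℕ → ℝ → ℝ} {g : ℝ → ℝ} (hs : Convex ℝ s)
    (hF : ∀ n, ConvexOn ℝ s (F n)) (hg : ∀ x ∈ s, Tendsto (F · x) atTop (𝓝 (g x))) :
    ConvexOn ℝ s g := by
  refine ⟨hs, fun x hx y hy a b ha hb hab => ?_⟩
  exact le_of_tendsto_of_tendsto' (hg _ (hs hx hy ha hb hab))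
    (((hg x hx).const_smul a).add ((hg y hy).const_smul b))
    fun n => (hF n).2 hx hy ha hb hab

lemma convexOn_mul_add_const (a b : ℝ) : ConvexOn ℝ (Ioi 0) fun x : ℝ => a * x + b := by
  refine ⟨convex_Ioi 0, fun x _ y _ c d _ _ hcd => le_of_eq ?_⟩
  simp only [smul_eq_mul]
  linear_combination -b * hcd

lemma convexOn_mul_log_sub_log_Gamma_add_one :
    ConvexOn ℝ (Ioi 0) fun x : ℝ => x * log x - log (Gamma (x + 1)) := by
  refine ConvexOn.of_tendsto (convex_Ioi 0)
    (F := fun n x => x * log x - (log x + BohrMollerup.logGammaSeq x n)) (fun n => ?_) ?_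
  · refine ((convexOn_mul_log_add_sum_log n).add
      (convexOn_mul_add_const (-log n) (-log n.factorial))).congr fun x _ => ?_
    simp only [Pi.add_apply, BohrMollerup.logGammaSeq, Finset.sum_range_succ', Nat.cast_zero,
      add_zero]
    ring
  · intro x (hx : 0 < x)
    rw [Gamma_add_one hx.ne', log_mul hx.ne' (Gamma_pos_of_pos hx).ne']
    exact ((BohrMollerup.tendsto_log_gamma hx).const_add _).const_sub _

lemma ConvexOn.strictMonoOn_div_sub {s : Set ℝ} {g : ℝ → ℝ} {a : ℝ} (hg : ConvexOn ℝ s g)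
    (ha : a ∈ s) (hga : g a < 0) : StrictMonoOn (fun x => g x / (x - a)) (s ∩ Ioi a) := by
  intro x ⟨hxs, (hx : a < x)⟩ y ⟨hys, (hy : a < y)⟩ hxy
  have h₁ := hg.secant_mono ha hxs hys hx.ne' hy.ne' hxy.le
  have h₂ : -g a / (y - a) < -g a / (x - a) :=
    div_lt_div_of_pos_left (by linarith) (by linarith) (by linarith)
  simp only [sub_div, neg_div] at h₁ h₂ ⊢
  linarith

/-- `(2x - 1) log f(2x)` for `f` the dimension constant. -/
noncomputable def logDimensionConstant (x : ℝ) : ℝ :=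
  (x * log x - log (Gamma (x + 1))) + (3 / 2) * (-log x) +
    ((log 2 + log π - 2 * log 4) * x + (-(5 / 2) * log 2 - log 4))

lemma convexOn_logDimensionConstant : ConvexOn ℝ (Ioi 0) logDimensionConstant :=
  (convexOn_mul_log_sub_log_Gamma_add_one.add
    (strictConcaveOn_log_Ioi.concaveOn.neg.smul (by norm_num : (0 : ℝ) ≤ 3 / 2))).add
    (convexOn_mul_add_const _ _)

lemma logDimensionConstant_half_neg : logDimensionConstant (1 / 2) < 0 := by
  have h4 : log 4 = 2 * log 2 := by
    rw [show (4 : ℝ) = 2 ^ 2 by norm_num, log_pow]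
    norm_num
  have hΓ : log (Gamma (1 / 2 + 1)) = -log 2 + log π / 2 := by
    rw [Gamma_add_one (by norm_num), Gamma_one_half_eq, log_mul (by norm_num) (by positivity),
      log_sqrt pi_pos.le, one_div, log_inv]
  have h2 : 0 < log 2 := log_pos (by norm_num)
  rw [logDimensionConstant, hΓ, h4, one_div, log_inv]
  linarith

lemma sqrt_mul_rpow_eq_exp {t : ℝ} (ht : 2 ≤ t) :
    √t * (π ^ (t / 2) / Gamma (t / 2 + 1) / (2 * (4 : ℝ) ^ (t + 1) * t)) ^ ((1 : ℝ) / (t - 1)) =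
      exp (logDimensionConstant (t / 2) / (t / 2 - 1 / 2) / 2) := by
  have h₀ : 0 < t := by linarith
  have h₁ : t - 1 ≠ 0 := by linarith
  have hΓ : 0 < Gamma (t / 2 + 1) := Gamma_pos_of_pos (by positivity)
  have hπ := pi_pos
  rw [← exp_log (show 0 < √t by positivity), rpow_def_of_pos (by positivity), ← exp_add,
    log_div (by positivity) (by positivity), log_div (by positivity) hΓ.ne',
    log_mul (by positivity) h₀.ne', log_mul (by norm_num) (by positivity), log_rpow hπ,
    log_rpow (by norm_num), log_sqrt h₀.le, logDimensionConstant,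
    log_div h₀.ne' (by norm_num), show t / 2 - 1 / 2 = (t - 1) / 2 by ring]
  congr 1
  field_simp
  ring

/-- The function `f(t) = √t · (v(t)/(2·4^{t+1}·t))^{1/(t-1)}`, where
`v(t) = π^{t/2}/Γ(t/2+1)` extends the volume of the unit ball, is strictly increasing on
`[2,∞)`, and `f(2) = √2·π/256 ≥ 1/90`. -/
theorem dimension_constant_monotone (f : ℝ → ℝ)
    (hf : ∀ t, f t = Real.sqrt t *
      (Real.pi ^ (t / 2) / Real.Gamma (t / 2 + 1) / (2 * (4 : ℝ) ^ (t + 1) * t)) ^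
        ((1 : ℝ) / (t - 1))) :
    StrictMonoOn f (Set.Ici 2) ∧ f 2 = Real.sqrt 2 * Real.pi / 256 ∧ (1 : ℝ) / 90 ≤ f 2 := by
  have h2 : f 2 = √2 * π / 256 := by
    rw [hf, show (2 : ℝ) / 2 + 1 = 2 by norm_num, Gamma_two,
      show (4 : ℝ) ^ ((2 : ℝ) + 1) = 64 by
        rw [show (2 : ℝ) + 1 = (3 : ℕ) by norm_num, rpow_natCast]; norm_num]
    norm_num
    ring
  refine ⟨fun x (hx : 2 ≤ x) y (hy : 2 ≤ y) hxy => ?_, h2, ?_⟩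
  · rw [hf, hf, sqrt_mul_rpow_eq_exp hx, sqrt_mul_rpow_eq_exp hy, exp_lt_exp]
    have hmem {t : ℝ} (ht : 2 ≤ t) : t / 2 ∈ Ioi (0 : ℝ) ∩ Ioi (1 / 2) :=
      ⟨show 0 < t / 2 by linarith, show 1 / 2 < t / 2 by linarith⟩
    have h := convexOn_logDimensionConstant.strictMonoOn_div_sub
      (show (0 : ℝ) < 1 / 2 by norm_num) logDimensionConstant_half_neg (hmem hx) (hmem hy)
      (by linarith)
    exact div_lt_div_of_pos_right h two_pos
  · rw [h2]
    have h₁ : 1 ≤ √2 := one_le_sqrt.mpr one_le_two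
    nlinarith [pi_gt_three]
end

section
/- Let g : ℝ → ℕ be finitely supported with total mass n = Σ_{t ∈ ℝ} g(t), let ℓ > 0 and m > 0 be reals, and let a ≤ b be reals. Suppose that for every x ∈ [a, b] one has g([x − ℓ, x + ℓ]) ≥ m. Then b − a ≤ 2ℓ · (n/m) + 2ℓ. -/
/-- The masses of finitely many pairwise disjoint sets add up to at most the total mass. -/
theorem sum_finsum_mem_le_finsum {α ι : Type*} {g : α → ℕ} (hg : (Function.support g).Finite)
    (s : Finset ι) (S : ι → Set α) (hS : (s : Set ι).PairwiseDisjoint S) :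
    ∑ i ∈ s, ∑ᶠ t ∈ S i, g t ≤ ∑ᶠ t, g t := by
  classical
  simp only [fun i => finsum_mem_eq_sum_filter g (S i) hg, finsum_eq_sum g hg]
  rw [← Finset.sum_biUnion]
  · refine Finset.sum_le_sum_of_subset fun t ht => ?_
    obtain ⟨i, -, hi⟩ := Finset.mem_biUnion.1 ht
    exact (Finset.mem_filter.1 hi).1
  · intro i hi j hj hij
    refine Finset.disjoint_left.2 fun t hti htj => ?_
    exact Set.disjoint_left.1 (hS hi hj hij) (Finset.mem_filter.1 hti).2 (Finset.mem_filter.1 htj).2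

/-- Closed windows of radius `ℓ` centred at the points of an arithmetic progression with step
greater than `2ℓ` are pairwise disjoint. -/
theorem pairwise_disjoint_Icc_arithmetic {ℓ d : ℝ} (hℓ : 0 ≤ ℓ) (hd : 2 * ℓ < d) (a : ℝ) :
    Pairwise (Function.onFun Disjoint
      fun i : ℕ => Set.Icc (a + i * d - ℓ) (a + i * d + ℓ)) := by
  refine (pairwise_disjoint_on _).2 fun i j hij => Set.disjoint_left.2 fun t hi hj => ?_
  have hij' : (i : ℝ) + 1 ≤ j := by exact_mod_cast hij
  nlinarith [hi.2, hj.1]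

/-- **Heavy-window counting.** If `g : ℝ → ℕ` is finitely supported with total mass `n`,
and every point `x` of `[a,b]` has `g([x-ℓ, x+ℓ]) ≥ m`, then `b - a ≤ 2ℓ·(n/m) + 2ℓ`. -/
theorem heavy_window_counting (g : ℝ → ℕ) (hg : (Function.support g).Finite)
    (ℓ m : ℝ) (hℓ : 0 < ℓ) (hm : 0 < m) (a b : ℝ) (hab : a ≤ b)
    (hheavy : ∀ x ∈ Set.Icc a b,
      m ≤ ((∑ᶠ t ∈ Set.Icc (x - ℓ) (x + ℓ), g t : ℕ) : ℝ)) :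
    b - a ≤ 2 * ℓ * (((∑ᶠ t, g t : ℕ) : ℝ) / m) + 2 * ℓ := by
  by_contra! hlt
  set n : ℕ := ∑ᶠ t, g t
  set q : ℕ := ⌊(n : ℝ) / m⌋₊
  have hq : (q : ℝ) ≤ n / m := Nat.floor_le (by positivity)
  have hq' : (n : ℝ) < (q + 1) * m := (div_lt_iff₀ hm).1 (Nat.lt_floor_add_one _)
  set d : ℝ := 2 * ℓ + 2 * ℓ / (q + 1) with hd
  have hd2 : 2 * ℓ < d := by
    have : 0 < 2 * ℓ / ((q : ℝ) + 1) := by positivity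
    linarith
  have hqd : q * d ≤ b - a := by
    have h1 : (q : ℝ) * (2 * ℓ / (q + 1)) ≤ 2 * ℓ := by
      rw [← mul_div_assoc, div_le_iff₀ (by positivity)]
      nlinarith
    have h2 : 2 * ℓ * q ≤ 2 * ℓ * (n / m) := by gcongr
    rw [hd, mul_add]
    linarith
  have hmem : ∀ i ∈ Finset.range (q + 1), a + i * d ∈ Set.Icc a b := by
    intro i hi
    have hi' : (i : ℝ) ≤ q := by exact_mod_cast Finset.mem_range_succ_iff.1 hi
    have hd0 : 0 ≤ d := by linarith
    have h1 : i * d ≤ q * d := by gcongr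
    have h2 : 0 ≤ i * d := by positivity
    constructor <;> linarith
  have hsum := Finset.sum_le_sum fun i hi => hheavy _ (hmem i hi)
  have hle := sum_finsum_mem_le_finsum hg (Finset.range (q + 1)) _
    ((pairwise_disjoint_Icc_arithmetic hℓ.le hd2 a).set_pairwise _)
  rw [Finset.sum_const, Finset.card_range, nsmul_eq_mul, Nat.cast_succ, ← Nat.cast_sum] at hsum
  exact absurd (hsum.trans (Nat.cast_le.2 hle)) (not_le.2 hq')
end

section
/- Let D ≥ 1 be an integer, let Q ⊂ ℝ^D be an embedded set, let c ∈ ℝ^D, and let w, ℓ > 0 be reals. Let H = c + [−w/2, w/2]^D be the cube of side length w centered at c, and H^+ = c + [−w/2 − ℓ, w/2 + ℓ]^D the concentric cube of side length w + 2ℓ. Then |Q ∩ (H^+ \ H)| ≤ 2D · (2^D / vol(B_D)) · (1 + ℓ) · (1 + w + 2ℓ)^{D−1}. -/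
open MeasureTheory

/-- The volume of an axis-parallel box in Euclidean space. -/
lemma EuclideanSpace.volume_box {ι : Type*} [Fintype ι] (a b : ι → ℝ) :
    volume {p : EuclideanSpace ℝ ι | ∀ i, p i ∈ Set.Icc (a i) (b i)} =
      ∏ i, ENNReal.ofReal (b i - a i) := by
  have h : {p : EuclideanSpace ℝ ι | ∀ i, p i ∈ Set.Icc (a i) (b i)} =
      WithLp.ofLp ⁻¹' Set.Icc a b := by
    ext p
    simp [Pi.le_def, forall_and]
  rw [h, (PiLp.volume_preserving_ofLp ι).measure_preimage
    measurableSet_Icc.nullMeasurableSet, Real.volume_Icc_pi]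

/-- Packing bound: a `1`-separated finite set inside a box with sides `b i - a i` has at most
`2 ^ D / vol(B_D) * ∏ i, (1 + (b i - a i))` points. -/
lemma card_le_of_separated_of_mem_box {D : ℕ} (S : Finset (EuclideanSpace ℝ (Fin D)))
    (hS : ∀ p ∈ S, ∀ q ∈ S, p ≠ q → 1 ≤ dist p q) (a b : Fin D → ℝ) (hab : ∀ i, a i ≤ b i)
    (hbox : ∀ p ∈ S, ∀ i, p i ∈ Set.Icc (a i) (b i)) :
    (S.card : ℝ) ≤
      2 ^ D / (volume (Metric.ball (0 : EuclideanSpace ℝ (Fin D)) 1)).toReal *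
        ∏ i, (1 + (b i - a i)) := by
  set V := volume (Metric.ball (0 : EuclideanSpace ℝ (Fin D)) 1) with hV
  have hV0 : 0 < V.toReal :=
    ENNReal.toReal_pos (Metric.measure_ball_pos _ _ one_pos).ne' measure_ball_lt_top.ne
  have hball (p : EuclideanSpace ℝ (Fin D)) :
      volume (Metric.ball p (1 / 2)) = ENNReal.ofReal ((1 / 2) ^ D) * V := by
    rw [Measure.addHaar_ball_of_pos _ _ (by norm_num), finrank_euclideanSpace_fin]
  have hdisj : (S : Set (EuclideanSpace ℝ (Fin D))).PairwiseDisjoint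
      fun p => Metric.ball p (1 / 2) := fun p hp q hq hpq =>
    Metric.ball_disjoint_ball (by linarith [hS p hp q hq hpq])
  have hsub : (⋃ p ∈ S, Metric.ball p (1 / 2)) ⊆
      {p : EuclideanSpace ℝ (Fin D) | ∀ i, p i ∈ Set.Icc (a i - 1 / 2) (b i + 1 / 2)} := by
    intro x hx i
    simp only [Set.mem_iUnion, Metric.mem_ball] at hx
    obtain ⟨p, hp, hxp⟩ := hx
    have h1 : |x i - p i| ≤ dist x p := by
      rw [dist_eq_norm]
      simpa using PiLp.norm_apply_le (x - p) i
    have h2 := abs_le.1 (h1.trans hxp.le)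
    have h3 := hbox p hp i
    exact ⟨by linarith [h3.1], by linarith [h3.2]⟩
  have hle := measure_mono (μ := volume) hsub
  rw [measure_biUnion_finset hdisj fun _ _ => measurableSet_ball,
    EuclideanSpace.volume_box] at hle
  simp only [hball, Finset.sum_const, nsmul_eq_mul] at hle
  have hreal := ENNReal.toReal_mono (ENNReal.prod_ne_top fun _ _ => ENNReal.ofReal_ne_top) hle
  have hprod : ∏ i, (ENNReal.ofReal (b i + 1 / 2 - (a i - 1 / 2))).toReal =
      ∏ i, (1 + (b i - a i)) := by
    refine Finset.prod_congr rfl fun i _ => ?_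
    rw [ENNReal.toReal_ofReal (by linarith [hab i])]
    ring
  rw [ENNReal.toReal_prod, hprod, ENNReal.toReal_mul, ENNReal.toReal_mul,
    ENNReal.toReal_natCast, ENNReal.toReal_ofReal (by positivity)] at hreal
  rw [div_mul_eq_mul_div, le_div_iff₀ hV0]
  calc (S.card : ℝ) * V.toReal
      = 2 ^ D * (S.card * ((1 / 2) ^ D * V.toReal)) := by
        rw [one_div, inv_pow]
        field_simp
    _ ≤ _ := by gcongr

/-- A `1`-separated finite set inside a slab, with one side of length `ℓ` and the remaining sides
of length `L`, has at most `2 ^ D / vol(B_D) * ((1 + ℓ) * (1 + L) ^ (D - 1))` points. -/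
lemma card_le_of_separated_of_mem_slab {D : ℕ} (S : Finset (EuclideanSpace ℝ (Fin D)))
    (hS : ∀ p ∈ S, ∀ q ∈ S, p ≠ q → 1 ≤ dist p q) (i : Fin D) (s : ℝ) (a : Fin D → ℝ)
    {ℓ L : ℝ} (hℓ : 0 ≤ ℓ) (hL : 0 ≤ L) (hi : ∀ p ∈ S, p i ∈ Set.Icc s (s + ℓ))
    (hbox : ∀ p ∈ S, ∀ j, p j ∈ Set.Icc (a j) (a j + L)) :
    (S.card : ℝ) ≤
      2 ^ D / (volume (Metric.ball (0 : EuclideanSpace ℝ (Fin D)) 1)).toReal *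
        ((1 + ℓ) * (1 + L) ^ (D - 1)) := by
  have h := card_le_of_separated_of_mem_box S hS (fun j => if j = i then s else a j)
    (fun j => if j = i then s + ℓ else a j + L)
    (fun j => by split_ifs <;> linarith)
    (fun p hp j => by
      dsimp only
      split_ifs with hj
      · exact hj ▸ hi p hp
      · exact hbox p hp j)
  refine h.trans_eq ?_
  rw [← Finset.mul_prod_erase _ _ (Finset.mem_univ i),
    Finset.prod_congr rfl (g := fun _ => 1 + L)
      (fun j hj => by simp [Finset.ne_of_mem_erase hj])]
  simp

/-- Bound on the 'type (ii)' points: an embedded set `Q ⊂ ℝ^D` meets the cubic shell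
`H⁺ \ H` (between the concentric cubes of side lengths `w` and `w + 2ℓ` centered at `c`)
in at most `2D · (2^D / vol(B_D)) · (1+ℓ) · (1+w+2ℓ)^{D-1}` points. -/
theorem outer_shell_count (D : ℕ) (hD : 1 ≤ D)
    (Q : Set (EuclideanSpace ℝ (Fin D))) (hQfin : Q.Finite)
    (hQ : ∀ p ∈ Q, ∀ q ∈ Q, p ≠ q → 1 ≤ dist p q)
    (c : EuclideanSpace ℝ (Fin D)) (w ℓ : ℝ) (hw : 0 < w) (hℓ : 0 < ℓ) :
    ((Q ∩ ({p : EuclideanSpace ℝ (Fin D) |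
          ∀ i, p i ∈ Set.Icc (c i - (w / 2 + ℓ)) (c i + (w / 2 + ℓ))} \
        {p : EuclideanSpace ℝ (Fin D) |
          ∀ i, p i ∈ Set.Icc (c i - w / 2) (c i + w / 2)})).ncard : ℝ) ≤
      2 * D * (2 ^ D / (volume (Metric.ball (0 : EuclideanSpace ℝ (Fin D)) 1)).toReal) *
        (1 + ℓ) * (1 + w + 2 * ℓ) ^ (D - 1) := by
  classical
  set K := 2 ^ D / (volume (Metric.ball (0 : EuclideanSpace ℝ (Fin D)) 1)).toReal *
    ((1 + ℓ) * (1 + (w + 2 * ℓ)) ^ (D - 1)) with hK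
  let T := hQfin.toFinset.filter fun p =>
    ∀ i, p i ∈ Set.Icc (c i - (w / 2 + ℓ)) (c i - (w / 2 + ℓ) + (w + 2 * ℓ))
  let F : Fin D × Bool → ℝ := fun x =>
    if x.2 then c x.1 + w / 2 else c x.1 - (w / 2 + ℓ)
  let slab : Fin D × Bool → Finset (EuclideanSpace ℝ (Fin D)) := fun x =>
    T.filter fun p => p x.1 ∈ Set.Icc (F x) (F x + ℓ)
  have hslab (x : Fin D × Bool) : ((slab x).card : ℝ) ≤ K := by
    refine card_le_of_separated_of_mem_slab (slab x) ?_ x.1 (F x)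
      (fun j => c j - (w / 2 + ℓ)) hℓ.le (by positivity) ?_ ?_
    · intro p hp q hq
      simp only [slab, T, Finset.mem_filter, Set.Finite.mem_toFinset] at hp hq
      exact hQ p hp.1.1 q hq.1.1
    · exact fun p hp => (Finset.mem_filter.1 hp).2
    · exact fun p hp => (Finset.mem_filter.1 (Finset.mem_filter.1 hp).1).2
  have hcover : Q ∩ ({p : EuclideanSpace ℝ (Fin D) |
          ∀ i, p i ∈ Set.Icc (c i - (w / 2 + ℓ)) (c i + (w / 2 + ℓ))} \
        {p : EuclideanSpace ℝ (Fin D) |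
          ∀ i, p i ∈ Set.Icc (c i - w / 2) (c i + w / 2)}) ⊆
      (Finset.univ.biUnion slab : Finset (EuclideanSpace ℝ (Fin D))) := by
    rintro p ⟨hpQ, hp, hpn⟩
    have hpT : p ∈ T := by
      simp only [T, Finset.mem_filter, Set.Finite.mem_toFinset]
      exact ⟨hpQ, fun i => ⟨(hp i).1, by linarith [(hp i).2]⟩⟩
    simp only [Set.mem_ofPred_eq, not_forall] at hpn
    obtain ⟨i, hi⟩ := hpn
    simp only [Finset.coe_biUnion, Set.mem_iUnion, Finset.mem_coe]
    rcases le_total (p i) (c i + w / 2) with h | h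
    · have h' : p i < c i - w / 2 := by
        by_contra! h'
        exact hi ⟨h', h⟩
      refine ⟨(i, false), Finset.mem_univ _, Finset.mem_filter.2 ⟨hpT, ?_⟩⟩
      simp only [F, Bool.false_eq_true, if_false]
      exact ⟨(hp i).1, by linarith⟩
    · refine ⟨(i, true), Finset.mem_univ _, Finset.mem_filter.2 ⟨hpT, ?_⟩⟩
      simp only [F, if_true]
      exact ⟨h, by linarith [(hp i).2]⟩
  calc _ ≤ ((Finset.univ.biUnion slab).card : ℝ) := by
        have h := Set.ncard_le_ncard hcover (Finset.finite_toSet _)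
        rw [Set.ncard_coe_finset] at h
        exact_mod_cast h
    _ ≤ ∑ x, ((slab x).card : ℝ) := by exact_mod_cast Finset.card_biUnion_le
    _ ≤ ∑ _x : Fin D × Bool, K := Finset.sum_le_sum fun x _ => hslab x
    _ = _ := by
        simp only [Finset.sum_const, Finset.card_univ, Fintype.card_prod, Fintype.card_fin,
          Fintype.card_bool, nsmul_eq_mul, hK, ← add_assoc]
        push_cast
        ring
end

section
/- Let D ≥ 1 be an integer, let Q ⊂ ℝ^D be an embedded set of cardinality at most n, let ℓ, m > 0 be reals, let j ∈ {1,…,D} be a coordinate, and let a ≤ b be reals. Suppose that for every x ∈ [a, b], the slab ℝ^{j−1} × [x − ℓ, x + ℓ] × ℝ^{D−j} contains at least m points of Q. Then b − a ≤ 2ℓ · (n/m) + 2ℓ. -/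
/-- If `k` intervals of radius `ℓ`, centred at points of an arithmetic progression with step
larger than `2 * ℓ`, each contain the `f`-values of at least `m` points of `S`, then `S` has at
least `k * m` points. -/
theorem mul_le_card_of_disjoint_slabs {α : Type*} (S : Finset α) (f : α → ℝ)
    {ℓ m a s : ℝ} (hs : 2 * ℓ < s) (hs0 : 0 ≤ s) (k : ℕ)
    (h : ∀ i < k, m ≤ ((S.filter fun p =>
      f p ∈ Set.Icc (a + i * s - ℓ) (a + i * s + ℓ)).card : ℝ)) :
    k * m ≤ S.card := by
  classical
  let T : ℕ → Finset α := fun i =>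
    S.filter fun p => f p ∈ Set.Icc (a + i * s - ℓ) (a + i * s + ℓ)
  have separated : ∀ i i' : ℕ, i < i' → Disjoint (T i) (T i') := by
    intro i i' hi
    refine Finset.disjoint_left.2 fun p hp hp' => ?_
    have h1 := (Finset.mem_filter.1 hp).2.2
    have h2 := (Finset.mem_filter.1 hp').2.1
    have h3 : (i : ℝ) + 1 ≤ i' := by exact_mod_cast hi
    linarith [mul_le_mul_of_nonneg_right h3 hs0]
  have hdisj : Set.PairwiseDisjoint (Finset.range k : Set ℕ) T := fun i _ i' _ hne =>
    hne.lt_or_gt.elim (separated i i') fun hlt => (separated i' i hlt).symm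
  have hcard : ∑ i ∈ Finset.range k, (T i).card ≤ S.card := by
    rw [← Finset.card_biUnion hdisj]
    exact Finset.card_le_card (Finset.biUnion_subset.2 fun i _ => Finset.filter_subset _ _)
  calc (k : ℝ) * m = ∑ _i ∈ Finset.range k, m := by simp
    _ ≤ ∑ i ∈ Finset.range k, ((T i).card : ℝ) :=
      Finset.sum_le_sum fun i hi => h i (Finset.mem_range.1 hi)
    _ ≤ S.card := by exact_mod_cast hcard

/-- **Strip-packing counting.** Let `Q ⊂ ℝ^D` be an embedded set of cardinality at most `n`.
If every `x ∈ [a,b]` is such that the slab `{p : p j ∈ [x-ℓ, x+ℓ]}` contains at least `m`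
points of `Q`, then `b - a ≤ 2ℓ·(n/m) + 2ℓ`. -/
theorem strip_packing_counting (D : ℕ) (hD : 1 ≤ D)
    (Q : Set (EuclideanSpace ℝ (Fin D))) (hQfin : Q.Finite)
    (hQ : ∀ p ∈ Q, ∀ q ∈ Q, p ≠ q → 1 ≤ dist p q)
    (n : ℕ) (hn : Q.ncard ≤ n) (ℓ m : ℝ) (hℓ : 0 < ℓ) (hm : 0 < m)
    (j : Fin D) (a b : ℝ) (hab : a ≤ b)
    (hheavy : ∀ x ∈ Set.Icc a b,
      m ≤ ((Q ∩ {p : EuclideanSpace ℝ (Fin D) | p j ∈ Set.Icc (x - ℓ) (x + ℓ)}).ncard : ℝ)) :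
    b - a ≤ 2 * ℓ * ((n : ℝ) / m) + 2 * ℓ := by
  by_contra! hlt
  set k : ℕ := ⌊(n : ℝ) / m⌋₊ + 1 with hk
  have hk0 : (0 : ℝ) < k := by positivity
  have hnk : (n : ℝ) < k * m := by
    rw [← div_lt_iff₀ hm, hk]
    exact_mod_cast Nat.lt_floor_add_one ((n : ℝ) / m)
  have hstep : 0 < 2 * ℓ / k := by positivity
  have key := mul_le_card_of_disjoint_slabs hQfin.toFinset (fun p => p j)
    (ℓ := ℓ) (m := m) (a := a) (s := 2 * ℓ + 2 * ℓ / k) (by linarith) (by positivity) k ?_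
  · rw [← Set.ncard_eq_toFinset_card Q hQfin] at key
    have : (Q.ncard : ℝ) ≤ n := by exact_mod_cast hn
    linarith
  · intro i hi
    have hin : (i : ℝ) ≤ n / m :=
      (Nat.cast_le.2 (Nat.lt_succ_iff.1 hi)).trans (Nat.floor_le (by positivity))
    have hik : (i : ℝ) * (2 * ℓ / k) ≤ 2 * ℓ := by
      have : (i : ℝ) ≤ k := by exact_mod_cast hi.le
      calc (i : ℝ) * (2 * ℓ / k) ≤ k * (2 * ℓ / k) := by gcongr
        _ = 2 * ℓ := by field_simp
    have hmul : (i : ℝ) * (2 * ℓ) ≤ n / m * (2 * ℓ) := by gcongr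
    refine (hheavy (a + i * (2 * ℓ + 2 * ℓ / k)) ⟨?_, ?_⟩).trans_eq ?_
    · exact le_add_of_nonneg_right (by positivity)
    · linarith
    · rw [← Set.ncard_coe_finset]
      congr 2
      ext p
      simp only [Finset.coe_filter, Set.Finite.mem_toFinset, Set.mem_inter_iff,
        Set.mem_ofPred_eq]
end
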